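/- arXiv:2405.11203 — 7 statements merged into one kernel-verified Lean document; each statement's English description precedes it below -/
import Mathlib

section
/- Let h > 0, ε > 0 and β = (β₁, β₂) ∈ ℝ². On T = [0,h]² define E(x) := e^{(β₁x₁ + β₂x₂)/ε}, the lowest-order edge basis functions φ₁(x) := ((h−x₂)/h², 0), φ₂(x) := (0, x₁/h²), φ₃(x) := (x₂/h², 0), φ₄(x) := (0, (h−x₁)/h²), and the edge functionals l₁(v) := ∫_0^h v₁(t,0) dt, l₂(v) := ∫_0^h v₂(h,t) dt, l₃(v) := ∫_0^h v₁(t,h) dt, l₄(v) := ∫_0^h v₂(0,t) dt. Define the discrete flux values J_i := ε · ( l₁(Eφ_i) + l₂(Eφ_i) − l₃(Eφ_i) − l₄(Eφ_i) ) / ∫_{[0,h]²} E(x) dx for i = 1,2,3,4. Then J₁ = h⁻² B_ε(β₂ h), J₂ = h⁻² B_ε(−β₁ h), J₃ = −h⁻² B_ε(−β₂ h), and J₄ = −h⁻² B_ε(β₁ h). -/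
/-- The Bernoulli function `B_ε(s) := ε / ∫_0^1 e^{s x / ε} dx`. -/
noncomputable def Bern (ε s : ℝ) : ℝ := ε / ∫ x in (0:ℝ)..1, Real.exp (s * x / ε)

/-- The exponential weight `E(x) := e^{(β₁x₁+β₂x₂)/ε}` on the element. -/
noncomputable def Efun (ε β₁ β₂ : ℝ) (p : ℝ × ℝ) : ℝ :=
  Real.exp ((β₁ * p.1 + β₂ * p.2) / ε)

/-- Lowest-order edge basis functions of `𝒩₀` on `T = [0,h]²`. -/
noncomputable def phi (h : ℝ) : Fin 4 → ℝ × ℝ → ℝ × ℝ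
  | 0 => fun p => ((h - p.2) / h ^ 2, 0)
  | 1 => fun p => (0, p.1 / h ^ 2)
  | 2 => fun p => (p.2 / h ^ 2, 0)
  | 3 => fun p => (0, (h - p.1) / h ^ 2)

/-- The signed sum of the tangential edge integrals
`l₁(v) + l₂(v) − l₃(v) − l₄(v)` on `T = [0,h]²`. -/
noncomputable def edgeSum (h : ℝ) (v : ℝ × ℝ → ℝ × ℝ) : ℝ :=
  (∫ t in (0:ℝ)..h, (v (t, 0)).1) + (∫ t in (0:ℝ)..h, (v (h, t)).2)
    - (∫ t in (0:ℝ)..h, (v (t, h)).1) - (∫ t in (0:ℝ)..h, (v (0, t)).2)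

/-- The discrete flux value
`J_i := ε (l₁(Eφᵢ) + l₂(Eφᵢ) − l₃(Eφᵢ) − l₄(Eφᵢ)) / ∫_{[0,h]²} E`. -/
noncomputable def Jval (ε β₁ β₂ h : ℝ) (i : Fin 4) : ℝ :=
  ε * edgeSum h (fun p => Efun ε β₁ β₂ p • phi h i p)
    / ∫ x₁ in (0:ℝ)..h, ∫ x₂ in (0:ℝ)..h, Efun ε β₁ β₂ (x₁, x₂)

theorem Efun_mk (ε β₁ β₂ x y : ℝ) :
    Efun ε β₁ β₂ (x, y) = Real.exp (β₁ * x / ε) * Real.exp (β₂ * y / ε) := by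
  rw [Efun, ← Real.exp_add, add_div]

theorem integral_exp_pos (b ε h : ℝ) (hh : 0 < h) :
    0 < ∫ t in (0:ℝ)..h, Real.exp (b * t / ε) :=
  intervalIntegral.intervalIntegral_pos_of_pos
    (Continuous.intervalIntegrable (by fun_prop) _ _) (fun _ => Real.exp_pos _) hh

/-- The Bernoulli function through the exponential integral over an edge of length `h`. -/
theorem Bern_mul (ε b h : ℝ) (hh : 0 < h) :
    Bern ε (b * h) = ε * h / ∫ t in (0:ℝ)..h, Real.exp (b * t / ε) := by
  have key : h * ∫ x in (0:ℝ)..1, Real.exp (b * h * x / ε) =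
      ∫ t in (0:ℝ)..h, Real.exp (b * t / ε) := by
    have := intervalIntegral.mul_integral_comp_mul_left (a := 0) (b := 1)
      (f := fun t => Real.exp (b * t / ε)) h
    simpa [mul_assoc] using this
  rw [Bern, ← key, mul_comm ε h, mul_div_mul_left _ _ hh.ne']

/-- The Bernoulli function at the reflected argument. -/
theorem Bern_neg_mul (ε b h : ℝ) (hh : 0 < h) :
    Bern ε (-(b * h)) =
      ε * h * Real.exp (b * h / ε) / ∫ t in (0:ℝ)..h, Real.exp (b * t / ε) := by
  have key : ∫ t in (0:ℝ)..h, Real.exp (b * t / ε) =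
      Real.exp (b * h / ε) * ∫ t in (0:ℝ)..h, Real.exp (-b * t / ε) := by
    have := intervalIntegral.integral_comp_sub_left (a := 0) (b := h)
      (fun t => Real.exp (b * t / ε)) h
    simp only [sub_self, sub_zero] at this
    rw [← this, ← intervalIntegral.integral_const_mul]
    refine intervalIntegral.integral_congr fun t _ => ?_
    simp only [← Real.exp_add]
    ring_nf
  rw [← neg_mul, Bern_mul ε (-b) h hh, key, mul_comm (ε * h),
    mul_div_mul_left _ _ (Real.exp_pos _).ne']

/-- The SAFE discrete flux values on a square element are given by the Bernoulli function:
`J₁ = h⁻² B_ε(β₂h)`, `J₂ = h⁻² B_ε(−β₁h)`, `J₃ = −h⁻² B_ε(−β₂h)`, `J₄ = −h⁻² B_ε(β₁h)`. -/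
theorem safe_discrete_flux_values (ε β₁ β₂ h : ℝ) (hε : 0 < ε) (hh : 0 < h) :
    Jval ε β₁ β₂ h 0 = h⁻¹ ^ 2 * Bern ε (β₂ * h)
    ∧ Jval ε β₁ β₂ h 1 = h⁻¹ ^ 2 * Bern ε (-(β₁ * h))
    ∧ Jval ε β₁ β₂ h 2 = -(h⁻¹ ^ 2 * Bern ε (-(β₂ * h)))
    ∧ Jval ε β₁ β₂ h 3 = -(h⁻¹ ^ 2 * Bern ε (β₁ * h)) := by
  have h₁ := (integral_exp_pos β₁ ε h hh).ne'
  have h₂ := (integral_exp_pos β₂ ε h hh).ne'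
  rw [Bern_mul ε β₂ h hh, Bern_mul ε β₁ h hh, Bern_neg_mul ε β₁ h hh, Bern_neg_mul ε β₂ h hh]
  simp only [Jval, edgeSum, phi, Efun_mk, Prod.smul_mk, smul_eq_mul, mul_zero,
    zero_div, sub_zero, sub_self, Real.exp_zero, one_mul, mul_one,
    intervalIntegral.integral_zero, intervalIntegral.integral_const_mul,
    intervalIntegral.integral_mul_const]
  refine ⟨?_, ?_, ?_, ?_⟩ <;> field_simp <;> ring
end

section
/- Let ε > 0, b = (b₁, b₂) ∈ ℝ² and θ = (θ₁, θ₂) ∈ ℝ². Then for all k₁, k₂ ∈ ℤ: (horizontal-edge identity) −B_ε(b₁) e^{i(θ₁k₁ + θ₂k₂)} + B_ε(−b₁) e^{i(θ₁(k₁+1) + θ₂k₂)} = ( b₁ cos(θ₁/2) + i sin(θ₁/2)(B_ε(b₁) + B_ε(−b₁)) ) · e^{i(θ₁(k₁+1/2) + θ₂k₂)}, and (vertical-edge identity) −B_ε(b₂) e^{i(θ₁k₁ + θ₂k₂)} + B_ε(−b₂) e^{i(θ₁k₁ + θ₂(k₂+1))} = ( b₂ cos(θ₂/2) + i sin(θ₂/2)(B_ε(b₂)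 + B_ε(−b₂)) ) · e^{i(θ₁k₁ + θ₂(k₂+1/2))}. (These state that the discrete gradient-flux grid operator J^grad_{ε,b} maps the nodal Fourier mode φ(θ) to the edge Fourier mode multiplied by the entries of the first column of the matrix H(θ), which is the key computation in the Fourier–Helmholtz splitting lemma.) -/
open Complex

theorem integral_exp_mul_div {ε s : ℝ} (hε : ε ≠ 0) (hs : s ≠ 0) :
    ∫ x in (0:ℝ)..1, Real.exp (s * x / ε) = ε / s * (Real.exp (s / ε) - 1) := by
  have hc : s / ε ≠ 0 := div_ne_zero hs hε
  have h : ∀ x : ℝ, s * x / ε = s / ε * x := fun x => by ring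
  simp only [h]
  rw [intervalIntegral.integral_comp_mul_left (fun x => Real.exp x) hc, integral_exp]
  simp

theorem Bern_eq {ε s : ℝ} (hε : ε ≠ 0) (hs : s ≠ 0) :
    Bern ε s = s / (Real.exp (s / ε) - 1) := by
  rw [Bern, integral_exp_mul_div hε hs]
  field_simp

theorem Bern_neg_sub_Bern {ε : ℝ} (hε : ε ≠ 0) (s : ℝ) : Bern ε (-s) - Bern ε s = s := by
  rcases eq_or_ne s 0 with rfl | hs
  · simp
  have hc : s / ε ≠ 0 := div_ne_zero hs hε
  have hexp : Real.exp (s / ε) - 1 ≠ 0 := by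
    rw [sub_ne_zero, Ne, Real.exp_eq_one_iff]
    exact hc
  have hexp' : 1 - Real.exp (s / ε) ≠ 0 := by
    rwa [← neg_sub, neg_ne_zero]
  have hpos : Real.exp (s / ε) ≠ 0 := (Real.exp_pos _).ne'
  rw [Bern_eq hε hs, Bern_eq hε (neg_ne_zero.mpr hs), neg_div ε s, Real.exp_neg]
  generalize Real.exp (s / ε) = a at *
  have h : a⁻¹ - 1 = (1 - a) / a := by field_simp
  rw [h]
  field_simp
  ring

/-- A two-point difference of exponentials, rewritten about the midpoint of the two phases. -/
theorem neg_mul_exp_add_mul_exp (p q θ z : ℂ) :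
    -p * exp (I * (z - θ / 2)) + q * exp (I * (z + θ / 2))
      = ((q - p) * cos (θ / 2) + I * sin (θ / 2) * (p + q)) * exp (I * z) := by
  have h₁ : exp (I * (z + θ / 2)) = exp (I * z) * (cos (θ / 2) + sin (θ / 2) * I) := by
    rw [← exp_mul_I, ← exp_add]
    ring_nf
  have h₂ : exp (I * (z - θ / 2)) = exp (I * z) * (cos (θ / 2) - sin (θ / 2) * I) := by
    rw [sub_eq_add_neg (cos _), ← neg_mul, ← sin_neg, ← cos_neg, ← exp_mul_I, ← exp_add]
    ring_nf
  rw [h₁, h₂]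
  ring

theorem Bern_flux_exp {ε : ℝ} (hε : ε ≠ 0) (b θ : ℝ) (z : ℂ) :
    -(Bern ε b : ℂ) * exp (I * (z - θ / 2)) + (Bern ε (-b) : ℂ) * exp (I * (z + θ / 2))
      = ((b : ℂ) * (Real.cos (θ / 2) : ℂ)
            + I * (Real.sin (θ / 2) : ℂ) * ((Bern ε b : ℂ) + (Bern ε (-b) : ℂ))) *
          exp (I * z) := by
  have hb : (Bern ε (-b) : ℂ) - (Bern ε b : ℂ) = b := by
    exact_mod_cast Bern_neg_sub_Bern hε b
  rw [neg_mul_exp_add_mul_exp, hb]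
  push_cast
  rfl

/-- The discrete gradient-flux grid operator maps the nodal Fourier mode
`φ(θ)_k = e^{i(θ₁k₁+θ₂k₂)}` to the edge Fourier mode multiplied by the entries of the first
column of `H(θ)`: the horizontal-edge identity
`−B_ε(b₁)e^{i(θ₁k₁+θ₂k₂)} + B_ε(−b₁)e^{i(θ₁(k₁+1)+θ₂k₂)}
  = (b₁cos(θ₁/2) + i sin(θ₁/2)(B_ε(b₁)+B_ε(−b₁))) e^{i(θ₁(k₁+1/2)+θ₂k₂)}`
and the vertical-edge analogue. -/
theorem Jgrad_fourier_mode (ε b₁ b₂ θ₁ θ₂ : ℝ) (hε : 0 < ε) (k₁ k₂ : ℤ) :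
    (-(Bern ε b₁ : ℂ) * Complex.exp (I * ((θ₁ : ℂ) * (k₁ : ℂ) + (θ₂ : ℂ) * (k₂ : ℂ)))
        + (Bern ε (-b₁) : ℂ) *
            Complex.exp (I * ((θ₁ : ℂ) * ((k₁ : ℂ) + 1) + (θ₂ : ℂ) * (k₂ : ℂ)))
      = ((b₁ : ℂ) * (Real.cos (θ₁ / 2) : ℂ)
            + I * (Real.sin (θ₁ / 2) : ℂ) * ((Bern ε b₁ : ℂ) + (Bern ε (-b₁) : ℂ))) *
          Complex.exp (I * ((θ₁ : ℂ) * ((k₁ : ℂ) + 1 / 2) + (θ₂ : ℂ) * (k₂ : ℂ))))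
    ∧ (-(Bern ε b₂ : ℂ) * Complex.exp (I * ((θ₁ : ℂ) * (k₁ : ℂ) + (θ₂ : ℂ) * (k₂ : ℂ)))
        + (Bern ε (-b₂) : ℂ) *
            Complex.exp (I * ((θ₁ : ℂ) * (k₁ : ℂ) + (θ₂ : ℂ) * ((k₂ : ℂ) + 1)))
      = ((b₂ : ℂ) * (Real.cos (θ₂ / 2) : ℂ)
            + I * (Real.sin (θ₂ / 2) : ℂ) * ((Bern ε b₂ : ℂ) + (Bern ε (-b₂) : ℂ))) *
          Complex.exp (I * ((θ₁ : ℂ) * (k₁ : ℂ) + (θ₂ : ℂ) * ((k₂ : ℂ) + 1 / 2)))) := by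
  constructor
  · convert Bern_flux_exp hε.ne' b₁ θ₁ (θ₁ * (k₁ + 1 / 2) + θ₂ * k₂) using 5 <;> ring
  · convert Bern_flux_exp hε.ne' b₂ θ₂ (θ₁ * k₁ + θ₂ * (k₂ + 1 / 2)) using 5 <;> ring
end

section
/- Let ε > 0 and b = (b₁, b₂) ∈ ℝ². For θ = (θ₁, θ₂) ∈ [−π/2, 3π/2)² with θ ≠ (0,0), the 2×2 complex matrix H(θ) := [[b₁ c₁ + i s₁ Σ₁, 2 i s₂], [b₂ c₂ + i s₂ Σ₂, −2 i s₁]] satisfies Re(det H(θ)) > 0, and for θ = (0,0) the matrix H₀ := [[i Σ₁, 2i], [i Σ₂, −2i]] satisfies Re(det H₀) > 0; in particular both matrices are invertible. Here s_j := sin(θ_j/2), c_j := cos(θ_j/2) and Σ_j := B_ε(b_j) + B_ε(−b_j). -/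
open Complex Real

/-- The change-of-basis matrix `H(θ)` of the Fourier–Helmholtz splitting, for `θ ≠ (0,0)`:
`H(θ) = [[b₁c₁ + i s₁Σ₁, 2is₂], [b₂c₂ + i s₂Σ₂, −2is₁]]` with `s_j = sin(θ_j/2)`,
`c_j = cos(θ_j/2)`, `Σ_j = B_ε(b_j) + B_ε(−b_j)`. -/
noncomputable def Hmat (ε b₁ b₂ θ₁ θ₂ : ℝ) : Matrix (Fin 2) (Fin 2) ℂ :=
  !![(b₁ : ℂ) * (Real.cos (θ₁ / 2) : ℂ)
        + I * (Real.sin (θ₁ / 2) : ℂ) * ((Bern ε b₁ : ℂ) + (Bern ε (-b₁) : ℂ)),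
      2 * I * (Real.sin (θ₂ / 2) : ℂ);
    (b₂ : ℂ) * (Real.cos (θ₂ / 2) : ℂ)
        + I * (Real.sin (θ₂ / 2) : ℂ) * ((Bern ε b₂ : ℂ) + (Bern ε (-b₂) : ℂ)),
      -2 * I * (Real.sin (θ₁ / 2) : ℂ)]

/-- The change-of-basis matrix at zero frequency:
`H₀ = [[iΣ₁, 2i], [iΣ₂, −2i]]`. -/
noncomputable def Hmat0 (ε b₁ b₂ : ℝ) : Matrix (Fin 2) (Fin 2) ℂ :=
  !![I * ((Bern ε b₁ : ℂ) + (Bern ε (-b₁) : ℂ)), 2 * I;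
    I * ((Bern ε b₂ : ℂ) + (Bern ε (-b₂) : ℂ)), -2 * I]

theorem Bern_pos {ε : ℝ} (hε : 0 < ε) (s : ℝ) : 0 < Bern ε s :=
  div_pos hε <| intervalIntegral.intervalIntegral_pos_of_pos
    (Continuous.intervalIntegrable (by fun_prop) _ _) (fun _ => Real.exp_pos _) one_pos

theorem sin_half_ne_zero {θ : ℝ} (h : θ ∈ Set.Ico (-(π / 2)) (3 * π / 2)) (hθ : θ ≠ 0) :
    Real.sin (θ / 2) ≠ 0 := by
  have hπ := Real.pi_pos
  rw [Ne, Real.sin_eq_zero_iff_of_lt_of_lt (by linarith [h.1]) (by linarith [h.2])]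
  simpa using hθ

theorem Hmat_det_re (ε b₁ b₂ θ₁ θ₂ : ℝ) :
    (Hmat ε b₁ b₂ θ₁ θ₂).det.re =
      2 * (Real.sin (θ₁ / 2) ^ 2 * (Bern ε b₁ + Bern ε (-b₁))
        + Real.sin (θ₂ / 2) ^ 2 * (Bern ε b₂ + Bern ε (-b₂))) := by
  simp only [Hmat, Matrix.det_fin_two_of, add_re, sub_re, mul_re, neg_re, add_im, mul_im, neg_im,
    ofReal_re, ofReal_im, I_re, I_im, re_ofNat, im_ofNat]
  ring

theorem Hmat0_det_re (ε b₁ b₂ : ℝ) :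
    (Hmat0 ε b₁ b₂).det.re =
      2 * ((Bern ε b₁ + Bern ε (-b₁)) + (Bern ε b₂ + Bern ε (-b₂))) := by
  simp only [Hmat0, Matrix.det_fin_two_of, add_re, sub_re, mul_re, neg_re, add_im, mul_im, neg_im,
    ofReal_re, ofReal_im, I_re, I_im, re_ofNat, im_ofNat]
  ring

theorem isUnit_of_det_re_pos {n : Type*} [Fintype n] [DecidableEq n] {A : Matrix n n ℂ}
    (h : 0 < A.det.re) : IsUnit A := by
  rw [Matrix.isUnit_iff_isUnit_det, isUnit_iff_ne_zero]
  intro h0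
  simp [h0] at h

/-- For `ε > 0`, `b ∈ ℝ²` and any frequency `θ ∈ [−π/2, 3π/2)²` with `θ ≠ (0,0)`, the
matrix `H(θ)` has `Re(det H(θ)) > 0`, and the zero-frequency matrix `H₀` has
`Re(det H₀) > 0`; in particular both matrices are invertible. -/
theorem Hmat_det_re_pos (ε b₁ b₂ θ₁ θ₂ : ℝ) (hε : 0 < ε)
    (h₁ : θ₁ ∈ Set.Ico (-(π / 2)) (3 * π / 2))
    (h₂ : θ₂ ∈ Set.Ico (-(π / 2)) (3 * π / 2))
    (hθ : (θ₁, θ₂) ≠ (0, 0)) :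
    0 < (Hmat ε b₁ b₂ θ₁ θ₂).det.re ∧ 0 < (Hmat0 ε b₁ b₂).det.re
    ∧ IsUnit (Hmat ε b₁ b₂ θ₁ θ₂) ∧ IsUnit (Hmat0 ε b₁ b₂) := by
  have h_sum (b : ℝ) : 0 < Bern ε b + Bern ε (-b) := add_pos (Bern_pos hε b) (Bern_pos hε (-b))
  have hH : 0 < (Hmat ε b₁ b₂ θ₁ θ₂).det.re := by
    rw [Hmat_det_re]
    refine mul_pos two_pos ?_
    by_cases h : θ₁ = 0
    · have hs := sin_half_ne_zero h₂ fun h' => hθ (by rw [h, h'])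
      exact add_pos_of_nonneg_of_pos (mul_nonneg (sq_nonneg _) (h_sum b₁).le)
        (mul_pos (by positivity) (h_sum b₂))
    · have hs := sin_half_ne_zero h₁ h
      exact add_pos_of_pos_of_nonneg (mul_pos (by positivity) (h_sum b₁))
        (mul_nonneg (sq_nonneg _) (h_sum b₂).le)
  have hH0 : 0 < (Hmat0 ε b₁ b₂).det.re := by
    rw [Hmat0_det_re]
    exact mul_pos two_pos (add_pos (h_sum b₁) (h_sum b₂))
  exact ⟨hH, hH0, isUnit_of_det_re_pos hH, isUnit_of_det_re_pos hH0⟩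
end

section
/- Let ε > 0, b = (b₁, b₂) ∈ ℝ², h > 0 and θ = (θ₁, θ₂) ∈ ℝ². With s_j := sin(θ_j/2), c_j := cos(θ_j/2), Σ_j := B_ε(b_j) + B_ε(−b_j), define K_Φ(θ) := h⁻² [[2 s₂² Σ₂ − i sin(θ₂) b₂, −2 s₁ s₂ Σ₁ + 2 i s₂ c₁ b₁], [−2 s₁ s₂ Σ₂ + 2 i s₁ c₂ b₂, 2 s₁² Σ₁ − i sin(θ₁) b₁]] and the row vector g(θ) := (−2 i s₁, −2 i s₂). Then g(θ) · K_Φ(θ) = (0, 0), i.e. the Fourier symbol of the transposed discrete gradient annihilates the Fourier symbol of the SAFE stiffness operator. -/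
open Complex

/-- The Fourier representation matrix `K_Φ(θ)` of the SAFE stiffness edge operator:
`K_Φ(θ) = h⁻²[[2s₂²Σ₂ − i sin(θ₂)b₂, −2s₁s₂Σ₁ + 2is₂c₁b₁],
              [−2s₁s₂Σ₂ + 2is₁c₂b₂, 2s₁²Σ₁ − i sin(θ₁)b₁]]`. -/
noncomputable def Kmat (ε b₁ b₂ h θ₁ θ₂ : ℝ) : Matrix (Fin 2) (Fin 2) ℂ :=
  ((h : ℂ) ^ 2)⁻¹ •
    !![2 * (Real.sin (θ₂ / 2) : ℂ) ^ 2 * ((Bern ε b₂ : ℂ) + (Bern ε (-b₂) : ℂ))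
          - I * (Real.sin θ₂ : ℂ) * (b₂ : ℂ),
        -2 * (Real.sin (θ₁ / 2) : ℂ) * (Real.sin (θ₂ / 2) : ℂ) *
            ((Bern ε b₁ : ℂ) + (Bern ε (-b₁) : ℂ))
          + 2 * I * (Real.sin (θ₂ / 2) : ℂ) * (Real.cos (θ₁ / 2) : ℂ) * (b₁ : ℂ);
      -2 * (Real.sin (θ₁ / 2) : ℂ) * (Real.sin (θ₂ / 2) : ℂ) *
            ((Bern ε b₂ : ℂ) + (Bern ε (-b₂) : ℂ))
          + 2 * I * (Real.sin (θ₁ / 2) : ℂ) * (Real.cos (θ₂ / 2) : ℂ) * (b₂ : ℂ),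
        2 * (Real.sin (θ₁ / 2) : ℂ) ^ 2 * ((Bern ε b₁ : ℂ) + (Bern ε (-b₁) : ℂ))
          - I * (Real.sin θ₁ : ℂ) * (b₁ : ℂ)]

/-- The Fourier symbol `g(θ) = (−2i sin(θ₁/2), −2i sin(θ₂/2))` of the transposed discrete
gradient grid operator `Gᵀ`, as a row vector. -/
noncomputable def gvec (θ₁ θ₂ : ℝ) : Matrix (Fin 1) (Fin 2) ℂ :=
  !![-2 * I * (Real.sin (θ₁ / 2) : ℂ), -2 * I * (Real.sin (θ₂ / 2) : ℂ)]

/-- The Fourier symbol of the transposed discrete gradient annihilates the Fourier symbol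
of the SAFE stiffness operator: `g(θ) · K_Φ(θ) = (0, 0)`. -/
theorem gvec_mul_Kmat_eq_zero (ε b₁ b₂ h θ₁ θ₂ : ℝ) (hε : 0 < ε) (hh : 0 < h) :
    gvec θ₁ θ₂ * Kmat ε b₁ b₂ h θ₁ θ₂ = 0 := by
  have sin_eq (θ : ℝ) : Real.sin θ = 2 * Real.sin (θ / 2) * Real.cos (θ / 2) := by
    rw [← Real.sin_two_mul, mul_div_cancel₀ θ two_ne_zero]
  rw [Kmat, Matrix.mul_smul, gvec, sin_eq θ₁, sin_eq θ₂]
  convert smul_zero _ using 2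
  ext i j
  fin_cases i
  fin_cases j <;>
  · simp only [Matrix.mul_apply, Fin.sum_univ_two]
    simp [-ofReal_sin, -ofReal_cos]
    ring
end

section
/- (Structure of the kernel-correction iteration matrix.) Let ε > 0, b = (b₁, b₂) ∈ ℝ², h > 0, γ > 0, θ = (θ₁, θ₂) ∈ ℝ² and s ∈ ℂ. With s_j := sin(θ_j/2), c_j := cos(θ_j/2), Σ_j := B_ε(b_j) + B_ε(−b_j), define K_Φ(θ), M_Φ(θ), H(θ) and g(θ) as the matrices K_Φ(θ) := h⁻² [[2 s₂² Σ₂ − i sin(θ₂) b₂, −2 s₁ s₂ Σ₁ + 2 i s₂ c₁ b₁], [−2 s₁ s₂ Σ₂ + 2 i s₁ c₂ b₂, 2 s₁² Σ₁ − i sin(θ₁) b₁]], M_Φ(θ) := (1/3) diag(2 + cos θ₂, 2 + cos θ₁), H(θ) := [[b₁ c₁ + i s₁ Σ₁, 2 i s₂], [b₂ c₂ + i s₂ Σ₂, −2 i s₁]], g(θ) := (−2 i s₁, −2 i s₂). Set A_Φ := K_Φ(θ) + γ M_Φ(θ) and D := (2 + cos θ₂) s₁² Σ₁ + (2 + cos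 θ₁) s₂² Σ₂ − (i/2)( sin(θ₁) b₁ (2 + cos θ₂) + sin(θ₂) b₂ (2 + cos θ₁) ). Assume H(θ) is invertible and D ≠ 0, and let a := g(θ) · A_Φ · (H(θ) e₁) (which is nonzero, being equal to (2γ/3)D). Define the 2×2 matrix S := I − (1 − s) a⁻¹ · e₁ · ( g(θ) A_Φ H(θ) ), where e₁ = (1,0)ᵀ and g(θ) A_Φ H(θ) is a row vector. Then S = [[s, 2(s−1) s₁ s₂ (cos θ₂ − cos θ₁) / D], [0, 1]]; in particular the lower-left entry of S is 0, its (1,1) entry is s and its (2,2) entry is 1. -/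
open Complex

/-- The Fourier representation matrix `M_Φ(θ) = (1/3) diag(2 + cos θ₂, 2 + cos θ₁)` of the
mass edge operator. -/
noncomputable def Mmat (θ₁ θ₂ : ℝ) : Matrix (Fin 2) (Fin 2) ℂ :=
  (3 : ℂ)⁻¹ • !![2 + (Real.cos θ₂ : ℂ), 0; 0, 2 + (Real.cos θ₁ : ℂ)]

/-- The symbol `A_Φ(θ) = K_Φ(θ) + γ M_Φ(θ)` of the full SAFE edge operator. -/
noncomputable def Amat (ε b₁ b₂ h γ θ₁ θ₂ : ℝ) : Matrix (Fin 2) (Fin 2) ℂ :=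
  Kmat ε b₁ b₂ h θ₁ θ₂ + (γ : ℂ) • Mmat θ₁ θ₂

/-- The quantity
`D = (2+cosθ₂)s₁²Σ₁ + (2+cosθ₁)s₂²Σ₂ − (i/2)(sin(θ₁)b₁(2+cosθ₂) + sin(θ₂)b₂(2+cosθ₁))`. -/
noncomputable def Dval (ε b₁ b₂ θ₁ θ₂ : ℝ) : ℂ :=
  (2 + (Real.cos θ₂ : ℂ)) * (Real.sin (θ₁ / 2) : ℂ) ^ 2 *
      ((Bern ε b₁ : ℂ) + (Bern ε (-b₁) : ℂ))
    + (2 + (Real.cos θ₁ : ℂ)) * (Real.sin (θ₂ / 2) : ℂ) ^ 2 *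
        ((Bern ε b₂ : ℂ) + (Bern ε (-b₂) : ℂ))
    - I / 2 * ((Real.sin θ₁ : ℂ) * (b₁ : ℂ) * (2 + (Real.cos θ₂ : ℂ))
        + (Real.sin θ₂ : ℂ) * (b₂ : ℂ) * (2 + (Real.cos θ₁ : ℂ)))

/-- The first standard column vector `e₁ = (1,0)ᵀ`. -/
noncomputable def e1col : Matrix (Fin 2) (Fin 1) ℂ := !![1; 0]

/-- The scalar `a := g(θ) · A_Φ · (H(θ)e₁)`. -/
noncomputable def aval (ε b₁ b₂ h γ θ₁ θ₂ : ℝ) : ℂ :=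
  (gvec θ₁ θ₂ * Amat ε b₁ b₂ h γ θ₁ θ₂ * (Hmat ε b₁ b₂ θ₁ θ₂ * e1col)) 0 0

/-- The kernel-correction iteration matrix
`S := I − (1 − s) a⁻¹ e₁ (g(θ) A_Φ H(θ))` in the Fourier–Helmholtz basis, where `s` is the
Fourier symbol of the auxiliary smoother. -/
noncomputable def Skc (ε b₁ b₂ h γ θ₁ θ₂ : ℝ) (s : ℂ) : Matrix (Fin 2) (Fin 2) ℂ :=
  1 - ((1 - s) * (aval ε b₁ b₂ h γ θ₁ θ₂)⁻¹) •
    (e1col * (gvec θ₁ θ₂ * Amat ε b₁ b₂ h γ θ₁ θ₂ * Hmat ε b₁ b₂ θ₁ θ₂))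

theorem sin_eq_two_mul_sin_half_mul_cos_half (θ : ℝ) :
    Real.sin θ = 2 * Real.sin (θ / 2) * Real.cos (θ / 2) := by
  rw [← Real.sin_two_mul, mul_div_cancel₀ θ two_ne_zero]

/-- The symbol of the gradient annihilates the stiffness symbol from the left. -/
theorem gvec_mul_Kmat (ε b₁ b₂ h θ₁ θ₂ : ℝ) :
    gvec θ₁ θ₂ * Kmat ε b₁ b₂ h θ₁ θ₂ = 0 := by
  rw [Kmat, Matrix.mul_smul, sin_eq_two_mul_sin_half_mul_cos_half θ₁,
    sin_eq_two_mul_sin_half_mul_cos_half θ₂]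
  refine smul_eq_zero_of_right _ ?_
  ext i j
  fin_cases i
  fin_cases j <;> simp [gvec, Matrix.mul_apply, Fin.sum_univ_two] <;> ring

theorem gvec_mul_Amat (ε b₁ b₂ h γ θ₁ θ₂ : ℝ) :
    gvec θ₁ θ₂ * Amat ε b₁ b₂ h γ θ₁ θ₂ = (γ : ℂ) • (gvec θ₁ θ₂ * Mmat θ₁ θ₂) := by
  rw [Amat, Matrix.mul_add, gvec_mul_Kmat, zero_add, Matrix.mul_smul]

theorem gvec_mul_Amat_mul_Hmat (ε b₁ b₂ h γ θ₁ θ₂ : ℝ) :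
    gvec θ₁ θ₂ * Amat ε b₁ b₂ h γ θ₁ θ₂ * Hmat ε b₁ b₂ θ₁ θ₂ =
      !![2 * (γ : ℂ) / 3 * Dval ε b₁ b₂ θ₁ θ₂,
        4 * (γ : ℂ) / 3 * (Real.sin (θ₁ / 2) : ℂ) * (Real.sin (θ₂ / 2) : ℂ) *
          ((Real.cos θ₂ : ℂ) - (Real.cos θ₁ : ℂ))] := by
  rw [gvec_mul_Amat, Dval, sin_eq_two_mul_sin_half_mul_cos_half θ₁,
    sin_eq_two_mul_sin_half_mul_cos_half θ₂]
  ext i j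
  fin_cases i
  fin_cases j <;>
    simp [gvec, Mmat, Hmat, Matrix.mul_apply, Fin.sum_univ_two, -ofReal_sin, -ofReal_cos] <;>
    ring_nf <;> simp only [I_sq] <;> ring

theorem aval_eq (ε b₁ b₂ h γ θ₁ θ₂ : ℝ) :
    aval ε b₁ b₂ h γ θ₁ θ₂ = 2 * (γ : ℂ) / 3 * Dval ε b₁ b₂ θ₁ θ₂ := by
  rw [aval, ← Matrix.mul_assoc, gvec_mul_Amat_mul_Hmat]
  simp [e1col, Matrix.mul_apply, Fin.sum_univ_two]

/-- Structure of the kernel-correction iteration matrix: assuming `H(θ)` is invertible and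
`D ≠ 0`, the scalar `a` equals `(2γ/3)D` (in particular it is nonzero) and
`S = [[s, 2(s−1)s₁s₂(cosθ₂−cosθ₁)/D], [0, 1]]`; in particular the lower-left entry of `S`
is `0`, its `(1,1)` entry is `s` and its `(2,2)` entry is `1`. -/
theorem kernel_correction_structure (ε b₁ b₂ h γ θ₁ θ₂ : ℝ) (s : ℂ)
    (hε : 0 < ε) (hh : 0 < h) (hγ : 0 < γ)
    (hH : IsUnit (Hmat ε b₁ b₂ θ₁ θ₂)) (hD : Dval ε b₁ b₂ θ₁ θ₂ ≠ 0) :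
    aval ε b₁ b₂ h γ θ₁ θ₂ = 2 * (γ : ℂ) / 3 * Dval ε b₁ b₂ θ₁ θ₂
    ∧ Skc ε b₁ b₂ h γ θ₁ θ₂ s
      = !![s, 2 * (s - 1) * (Real.sin (θ₁ / 2) : ℂ) * (Real.sin (θ₂ / 2) : ℂ) *
              ((Real.cos θ₂ : ℂ) - (Real.cos θ₁ : ℂ)) / Dval ε b₁ b₂ θ₁ θ₂;
          0, 1] := by
  have hγ' : (γ : ℂ) ≠ 0 := ofReal_ne_zero.mpr hγ.ne'
  refine ⟨aval_eq .., ?_⟩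
  rw [Skc, aval_eq, gvec_mul_Amat_mul_Hmat]
  ext i j
  fin_cases i <;> fin_cases j <;>
    simp [e1col, -ofReal_sin, -ofReal_cos] <;> field_simp <;> ring
end

section
/- Let ε > 0 and b = (b₁, b₂) ∈ ℝ². For every θ = (θ₁, θ₂) ∈ [−π/2, 3π/2)² with θ ≠ (0,0), the quantity D := (2 + cos θ₂) sin²(θ₁/2) (B_ε(b₁) + B_ε(−b₁)) + (2 + cos θ₁) sin²(θ₂/2) (B_ε(b₂) + B_ε(−b₂)) − (i/2)( sin(θ₁) b₁ (2 + cos θ₂) + sin(θ₂) b₂ (2 + cos θ₁) ) has strictly positive real part; in particular D ≠ 0, so the Fourier symbol of the auxiliary operator A^aux at every nonzero frequency in [−π/2, 3π/2)² is nonzero. -/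
open Complex Real

theorem Dval_re (ε b₁ b₂ θ₁ θ₂ : ℝ) :
    (Dval ε b₁ b₂ θ₁ θ₂).re =
      (2 + Real.cos θ₂) * Real.sin (θ₁ / 2) ^ 2 * (Bern ε b₁ + Bern ε (-b₁))
        + (2 + Real.cos θ₁) * Real.sin (θ₂ / 2) ^ 2 * (Bern ε b₂ + Bern ε (-b₂)) := by
  have h : Dval ε b₁ b₂ θ₁ θ₂ =
      (((2 + Real.cos θ₂) * Real.sin (θ₁ / 2) ^ 2 * (Bern ε b₁ + Bern ε (-b₁))
        + (2 + Real.cos θ₁) * Real.sin (θ₂ / 2) ^ 2 * (Bern ε b₂ + Bern ε (-b₂)) : ℝ) : ℂ)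
      + ((-(Real.sin θ₁ * b₁ * (2 + Real.cos θ₂)
        + Real.sin θ₂ * b₂ * (2 + Real.cos θ₁)) / 2 : ℝ) : ℂ) * I := by
    unfold Dval
    push_cast
    ring
  rw [h, add_re, re_ofReal_mul, I_re, mul_zero, add_zero, ofReal_re]

/-- For every `ε > 0`, `b ∈ ℝ²` and every frequency `θ ∈ [−π/2, 3π/2)²` with `θ ≠ (0,0)`,
the quantity `D` has strictly positive real part; in particular `D ≠ 0`, so the Fourier
symbol of the auxiliary operator at every nonzero frequency is nonzero. -/
theorem Dval_re_pos (ε b₁ b₂ θ₁ θ₂ : ℝ) (hε : 0 < ε)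
    (h₁ : θ₁ ∈ Set.Ico (-(π / 2)) (3 * π / 2))
    (h₂ : θ₂ ∈ Set.Ico (-(π / 2)) (3 * π / 2))
    (hθ : (θ₁, θ₂) ≠ (0, 0)) :
    0 < (Dval ε b₁ b₂ θ₁ θ₂).re ∧ Dval ε b₁ b₂ θ₁ θ₂ ≠ 0 := by
  have hre : 0 < (Dval ε b₁ b₂ θ₁ θ₂).re := by
    have hB₁ := add_pos (Bern_pos hε b₁) (Bern_pos hε (-b₁))
    have hB₂ := add_pos (Bern_pos hε b₂) (Bern_pos hε (-b₂))
    have hc₁ : 0 < 2 + Real.cos θ₁ := by linarith [Real.neg_one_le_cos θ₁]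
    have hc₂ : 0 < 2 + Real.cos θ₂ := by linarith [Real.neg_one_le_cos θ₂]
    rw [Dval_re]
    by_cases h : θ₁ = 0
    · have hs := sin_half_ne_zero h₂ fun h' => hθ (Prod.ext h h')
      exact add_pos_of_nonneg_of_pos (by positivity) (by positivity)
    · have hs := sin_half_ne_zero h₁ h
      exact add_pos_of_pos_of_nonneg (by positivity) (by positivity)
  exact ⟨hre, fun h => hre.ne' (by rw [h, zero_re])⟩
end

section
/- (Fourier invariance of the SAFE stiffness stencil.) Let ε > 0, b = (b₁, b₂) ∈ ℝ², h > 0, θ = (θ₁, θ₂) ∈ ℝ² and α₁, α₂ ∈ ℂ. Define edge grid functions f_H, f_V : ℤ² → ℂ by f_H(k₁,k₂) := α₁ e^{i(θ₁(k₁+1/2) + θ₂k₂)} and f_V(k₁,k₂) := α₂ e^{i(θ₁k₁ + θ₂(k₂+1/2))}. Define, for each k = (k₁,k₂) ∈ ℤ², (Kf)_H(k) := h⁻²[ (B_ε(b₂)+B_ε(−b₂)) f_H(k) − B_ε(−b₂) f_H(k₁,k₂+1) − B_ε(b₂) f_H(k₁,k₂−1) − B_ε(b₁) f_V(k₁,k₂)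 + B_ε(−b₁) f_V(k₁+1,k₂) + B_ε(b₁) f_V(k₁,k₂−1) − B_ε(−b₁) f_V(k₁+1,k₂−1) ] and (Kf)_V(k) := h⁻²[ (B_ε(b₁)+B_ε(−b₁)) f_V(k) − B_ε(b₁) f_V(k₁−1,k₂) − B_ε(−b₁) f_V(k₁+1,k₂) − B_ε(−b₂) f_H(k₁−1,k₂+1) + B_ε(−b₂) f_H(k₁,k₂+1) + B_ε(b₂) f_H(k₁−1,k₂) − B_ε(b₂) f_H(k₁,k₂) ]. Then with K_Φ(θ) := h⁻² [[2 s₂² Σ₂ − i sin(θ₂) b₂, −2 s₁ s₂ Σ₁ + 2 i s₂ c₁ b₁], [−2 s₁ s₂ Σ₂ + 2 i s₁ c₂ b₂, 2 s₁² Σ₁ − i sin(θ₁) b₁]] (where s_j := sin(θ_j/2), c_j := cos(θ_j/2), Σ_j := B_ε(b_j)+B_ε(−b_j)), one has for every k ∈ ℤ²: (Kf)_H(k) = (K_Φ(θ)·(α₁,α₂)ᵀ)₁ · e^{i(θ₁(k₁+1/2)+θ₂k₂)} and (Kf)_V(k) = (K_Φ(θ)·(α₁,α₂)ᵀ)₂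 · e^{i(θ₁k₁+θ₂(k₂+1/2))}. -/
open Complex

/-- The horizontal-edge component of the edge Fourier mode:
`f_H(k₁,k₂) = α₁ e^{i(θ₁(k₁+1/2)+θ₂k₂)}`. -/
noncomputable def modeH (θ₁ θ₂ : ℝ) (α₁ : ℂ) (k₁ k₂ : ℤ) : ℂ :=
  α₁ * Complex.exp (I * ((θ₁ : ℂ) * ((k₁ : ℂ) + 1 / 2) + (θ₂ : ℂ) * (k₂ : ℂ)))

/-- The vertical-edge component of the edge Fourier mode:
`f_V(k₁,k₂) = α₂ e^{i(θ₁k₁+θ₂(k₂+1/2))}`. -/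
noncomputable def modeV (θ₁ θ₂ : ℝ) (α₂ : ℂ) (k₁ k₂ : ℤ) : ℂ :=
  α₂ * Complex.exp (I * ((θ₁ : ℂ) * (k₁ : ℂ) + (θ₂ : ℂ) * ((k₂ : ℂ) + 1 / 2)))

/-- The horizontal-edge stencil of the SAFE stiffness edge operator `K` applied to the edge
grid function `(f_H, f_V)` at the horizontal edge indexed by `k`. -/
noncomputable def KstencilH (ε b₁ b₂ h : ℝ) (fH fV : ℤ → ℤ → ℂ) (k₁ k₂ : ℤ) : ℂ :=
  ((h : ℂ) ^ 2)⁻¹ *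
    (((Bern ε b₂ : ℂ) + (Bern ε (-b₂) : ℂ)) * fH k₁ k₂
      - (Bern ε (-b₂) : ℂ) * fH k₁ (k₂ + 1)
      - (Bern ε b₂ : ℂ) * fH k₁ (k₂ - 1)
      - (Bern ε b₁ : ℂ) * fV k₁ k₂
      + (Bern ε (-b₁) : ℂ) * fV (k₁ + 1) k₂
      + (Bern ε b₁ : ℂ) * fV k₁ (k₂ - 1)
      - (Bern ε (-b₁) : ℂ) * fV (k₁ + 1) (k₂ - 1))

/-- The vertical-edge stencil of the SAFE stiffness edge operator `K` applied to the edge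
grid function `(f_H, f_V)` at the vertical edge indexed by `k`. -/
noncomputable def KstencilV (ε b₁ b₂ h : ℝ) (fH fV : ℤ → ℤ → ℂ) (k₁ k₂ : ℤ) : ℂ :=
  ((h : ℂ) ^ 2)⁻¹ *
    (((Bern ε b₁ : ℂ) + (Bern ε (-b₁) : ℂ)) * fV k₁ k₂
      - (Bern ε b₁ : ℂ) * fV (k₁ - 1) k₂
      - (Bern ε (-b₁) : ℂ) * fV (k₁ + 1) k₂
      - (Bern ε (-b₂) : ℂ) * fH (k₁ - 1) (k₂ + 1)
      + (Bern ε (-b₂) : ℂ) * fH k₁ (k₂ + 1)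
      + (Bern ε b₂ : ℂ) * fH (k₁ - 1) k₂
      - (Bern ε b₂ : ℂ) * fH k₁ k₂)

theorem Bern_neg {ε : ℝ} (hε : ε ≠ 0) (s : ℝ) : Bern ε (-s) = Bern ε s + s := by
  rcases eq_or_ne s 0 with rfl | hs
  · simp
  have h₁ : Real.exp (s / ε) - 1 ≠ 0 := by
    rw [sub_ne_zero, Ne, Real.exp_eq_one_iff]
    exact div_ne_zero hs hε
  rw [Bern, Bern, integral_exp_mul_div hε hs, integral_exp_mul_div hε (neg_ne_zero.mpr hs),
    neg_div, Real.exp_neg]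
  have h₂ := Real.exp_ne_zero (s / ε)
  generalize Real.exp (s / ε) = E at *
  have h₃ : E⁻¹ - 1 = -(E - 1) / E := by field_simp; ring
  rw [h₃]
  field_simp
  ring

theorem exp_I_mul_half_int_phase (θ φ : ℂ) (m n : ℤ) :
    Complex.exp (I * (θ * ((m : ℂ) + 1 / 2) + φ * (n : ℂ)))
      = Complex.exp (θ / 2 * I) ^ (2 * m + 1) * Complex.exp (φ / 2 * I) ^ (2 * n) := by
  rw [← Complex.exp_int_mul, ← Complex.exp_int_mul, ← Complex.exp_add]
  congr 1
  push_cast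
  ring

/-- Fourier invariance of the SAFE stiffness stencil: applying the horizontal- and
vertical-edge stencils of `K` to the edge Fourier mode `(f_H, f_V)` with amplitudes
`(α₁, α₂)` reproduces the same mode with amplitudes `K_Φ(θ)·(α₁,α₂)ᵀ`. -/
theorem K_stencil_fourier_invariance (ε b₁ b₂ h θ₁ θ₂ : ℝ) (α₁ α₂ : ℂ)
    (hε : 0 < ε) (hh : 0 < h) :
    ∀ k₁ k₂ : ℤ,
      KstencilH ε b₁ b₂ h (modeH θ₁ θ₂ α₁) (modeV θ₁ θ₂ α₂) k₁ k₂
        = (Kmat ε b₁ b₂ h θ₁ θ₂).mulVec ![α₁, α₂] 0 *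
            Complex.exp (I * ((θ₁ : ℂ) * ((k₁ : ℂ) + 1 / 2) + (θ₂ : ℂ) * (k₂ : ℂ)))
      ∧ KstencilV ε b₁ b₂ h (modeH θ₁ θ₂ α₁) (modeV θ₁ θ₂ α₂) k₁ k₂
        = (Kmat ε b₁ b₂ h θ₁ θ₂).mulVec ![α₁, α₂] 1 *
            Complex.exp (I * ((θ₁ : ℂ) * (k₁ : ℂ) + (θ₂ : ℂ) * ((k₂ : ℂ) + 1 / 2))) := by
  intro k₁ k₂
  have hV : ∀ m n : ℤ, Complex.exp (I * ((θ₁ : ℂ) * (m : ℂ) + (θ₂ : ℂ) * ((n : ℂ) + 1 / 2)))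
      = Complex.exp (θ₁ / 2 * I) ^ (2 * m) * Complex.exp (θ₂ / 2 * I) ^ (2 * n + 1) := fun m n => by
    rw [add_comm, exp_I_mul_half_int_phase, mul_comm]
  have hsin : ∀ θ : ℝ, Complex.sin θ = 2 * Complex.sin (θ / 2) * Complex.cos (θ / 2) := fun θ => by
    rw [← Complex.sin_two_mul, mul_div_cancel₀ _ two_ne_zero]
  have hP₁ := Complex.exp_ne_zero (θ₁ / 2 * I)
  have hP₂ := Complex.exp_ne_zero (θ₂ / 2 * I)
  simp only [KstencilH, KstencilV, modeH, modeV, Kmat, Matrix.mulVec, dotProduct,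
    Fin.sum_univ_two, Matrix.smul_apply, Matrix.of_apply, Matrix.cons_val', Matrix.cons_val_zero,
    Matrix.cons_val_one, Matrix.cons_val_fin_one, smul_eq_mul, Bern_neg hε.ne', hV,
    exp_I_mul_half_int_phase, Complex.ofReal_add, Complex.ofReal_sin, Complex.ofReal_cos,
    Complex.ofReal_div, Complex.ofReal_ofNat, hsin]
  simp only [Complex.sin, Complex.cos, neg_mul, Complex.exp_neg]
  generalize Complex.exp (θ₁ / 2 * I) = P at *
  generalize Complex.exp (θ₂ / 2 * I) = Q at *
  simp only [mul_add (2 : ℤ), mul_sub (2 : ℤ), mul_one, zpow_add₀ hP₁, zpow_sub₀ hP₁,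
    zpow_add₀ hP₂, zpow_sub₀ hP₂, zpow_ofNat]
  generalize P ^ (2 * k₁) = A
  generalize Q ^ (2 * k₂) = B
  constructor <;>
  · field_simp
    simp only [Complex.I_sq]
    ring
end
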